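/- Over a commutative ring R, the associative R-algebra A generated by f_1,…,f_n with the relations f_i f_j = α_{ij} f_j + α_{ji} f_i + c_{ij} for all i ≠ j (where α_{ij}, c_{ij} = c_{ji} ∈ R) has {1} ∪ {f_i^m : 1 ≤ i ≤ n, m ≥ 1} as an R-basis if and only if for all triples of distinct indices i, j, k: c_{ij} = α_{ik}α_{jk} − α_{ij}α_{jk} − α_{ji}α_{ik}. -/

import Mathlib

open MvPolynomial in
/-- The ideal of relations `fᵢfⱼ = αᵢⱼ fⱼ + αⱼᵢ fᵢ + cᵢⱼ` (for `i ≠ j`) in the polynomial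
ring `R[f₁,…,fₙ]`. -/
noncomputable def stmt9Ideal {R : Type*} [CommRing R] (n : ℕ) (α c : Fin n → Fin n → R) :
    Ideal (MvPolynomial (Fin n) R) :=
  Ideal.span {P | ∃ i j : Fin n, i ≠ j ∧
    P = X i * X j - C (α i j) * X j - C (α j i) * X i - C (c i j)}

/-- The family of monomials `1` and `fᵢᵐ` (`m ≥ 1`) in the quotient algebra
`A = R[f₁,…,fₙ]/(fᵢfⱼ − αᵢⱼfⱼ − αⱼᵢfᵢ − cᵢⱼ)`. -/
noncomputable def stmt9Monomial {R : Type*} [CommRing R] (n : ℕ) (α c : Fin n → Fin n → R) :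
    Option (Fin n × ℕ) → (MvPolynomial (Fin n) R ⧸ stmt9Ideal n α c) :=
  fun p => p.elim 1 fun q =>
    (Ideal.Quotient.mk (stmt9Ideal n α c) (MvPolynomial.X q.1)) ^ (q.2 + 1)

theorem s9_smul {R : Type*} [CommRing R] (n : ℕ) (α c : Fin n → Fin n → R) (r : R)
    (x : MvPolynomial (Fin n) R ⧸ stmt9Ideal n α c) :
    r • x = algebraMap R (MvPolynomial (Fin n) R ⧸ stmt9Ideal n α c) r * x :=
  Algebra.smul_def r x

open MvPolynomial in
theorem s9_rel {R : Type*} [CommRing R] (n : ℕ) (α c : Fin n → Fin n → R) (i j : Fin n)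
    (h : i ≠ j) :
    (Ideal.Quotient.mk (stmt9Ideal n α c) (X i)) * (Ideal.Quotient.mk (stmt9Ideal n α c) (X j)) =
      algebraMap R _ (α i j) * (Ideal.Quotient.mk (stmt9Ideal n α c) (X j)) +
      algebraMap R _ (α j i) * (Ideal.Quotient.mk (stmt9Ideal n α c) (X i)) +
      algebraMap R _ (c i j) := by
  have h1 : (X i * X j - C (α i j) * X j - C (α j i) * X i - C (c i j) :
      MvPolynomial (Fin n) R) ∈ stmt9Ideal n α c :=
    Ideal.subset_span ⟨i, j, h, rfl⟩
  have h2 := Ideal.Quotient.eq_zero_iff_mem.mpr h1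
  have hC : ∀ r : R, Ideal.Quotient.mk (stmt9Ideal n α c) (C r) = algebraMap R _ r :=
    fun r => rfl
  simp only [map_sub, map_mul, hC] at h2
  linear_combination h2

theorem s9_mulpow {R : Type*} [CommRing R] (n : ℕ) (α c : Fin n → Fin n → R) (i j : Fin n)
    (m : ℕ) :
    (Ideal.Quotient.mk (stmt9Ideal n α c) (MvPolynomial.X i)) *
      (Ideal.Quotient.mk (stmt9Ideal n α c) (MvPolynomial.X j)) ^ m ∈
      Submodule.span R (Set.range (stmt9Monomial n α c)) := by
  have hpow : ∀ (i : Fin n) (m : ℕ), (Ideal.Quotient.mk (stmt9Ideal n α c) (MvPolynomial.X i)) ^ m ∈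
      Submodule.span R (Set.range (stmt9Monomial n α c)) := by
    intro i m
    apply Submodule.subset_span
    cases m with
    | zero => exact ⟨none, by simp [stmt9Monomial]⟩
    | succ m => exact ⟨some (i, m), rfl⟩
  by_cases h : i = j
  · subst h
    rw [← pow_succ']
    exact hpow _ _
  · induction m with
    | zero => simpa using hpow i 1
    | succ m ih =>
      rw [pow_succ', ← mul_assoc, s9_rel n α c i j h]
      have e : ∀ (a b d : R) (x y : MvPolynomial (Fin n) R ⧸ stmt9Ideal n α c),
          (algebraMap R _ a * y + algebraMap R _ b * x + algebraMap R _ d) * y ^ m =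
          a • y ^ (m+1) + b • (x * y ^ m) + d • y ^ m := by
        intro a b d x y
        simp only [s9_smul]
        ring
      rw [e]
      exact add_mem (add_mem (Submodule.smul_mem _ _ (hpow _ _)) (Submodule.smul_mem _ _ ih))
        (Submodule.smul_mem _ _ (hpow _ _))

theorem s9_span {R : Type*} [CommRing R] (n : ℕ) (α c : Fin n → Fin n → R) :
    Submodule.span R (Set.range (stmt9Monomial n α c)) = ⊤ := by
  have hmul : ∀ i : Fin n, ∀ y ∈ Submodule.span R (Set.range (stmt9Monomial n α c)),
      y * Ideal.Quotient.mk (stmt9Ideal n α c) (MvPolynomial.X i) ∈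
        Submodule.span R (Set.range (stmt9Monomial n α c)) := by
    intro i y hy
    induction hy using Submodule.span_induction with
    | mem x hx =>
      obtain ⟨p, rfl⟩ := hx
      rw [mul_comm]
      rcases p with _ | ⟨j, m⟩
      · simpa [stmt9Monomial] using s9_mulpow n α c i i 0
      · exact s9_mulpow n α c i j (m+1)
    | zero => simp
    | add x y _ _ hx hy => rw [add_mul]; exact add_mem hx hy
    | smul a x _ hx => rw [s9_smul, mul_assoc, ← s9_smul]; exact Submodule.smul_mem _ _ hx
  rw [eq_top_iff]
  rintro y -
  obtain ⟨p, rfl⟩ := Ideal.Quotient.mk_surjective y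
  induction p using MvPolynomial.induction_on with
  | C a =>
    have : Ideal.Quotient.mk (stmt9Ideal n α c) (MvPolynomial.C a) =
        a • stmt9Monomial n α c none := by
      rw [s9_smul]
      simp only [stmt9Monomial, Option.elim, mul_one]
      rfl
    rw [this]
    exact Submodule.smul_mem _ _ (Submodule.subset_span ⟨_, rfl⟩)
  | add p q hp hq => rw [map_add]; exact add_mem hp hq
  | mul_X p i hp => rw [map_mul]; exact hmul i _ hp

/-- the power series `t / (1 - a t)`, that is `1 / (x - a)` for `x = 1 / t` -/
noncomputable def s9U {R : Type*} [CommRing R] (a : R) : PowerSeries R :=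
  PowerSeries.X * PowerSeries.mk fun k => a ^ k

noncomputable def s9x (R : Type*) [CommRing R] : HahnSeries ℤ R := HahnSeries.single (-1) 1

theorem s9U_eq {R : Type*} [CommRing R] (a : R) :
    s9U a = PowerSeries.X * (1 + PowerSeries.C a * s9U a) := by
  unfold s9U
  congr 1
  ext k
  cases k with
  | zero => simp
  | succ k => simp [mul_left_comm, PowerSeries.coeff_succ_X_mul, pow_succ', PowerSeries.coeff_one]

theorem s9_ofC {R : Type*} [CommRing R] (a : R) :
    HahnSeries.ofPowerSeries ℤ R (PowerSeries.C a) = algebraMap R (HahnSeries ℤ R) a := by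
  rw [HahnSeries.algebraMap_apply']; rfl

theorem s9xU {R : Type*} [CommRing R] (a : R) :
    s9x R * HahnSeries.ofPowerSeries ℤ R (s9U a) =
      1 + algebraMap R (HahnSeries ℤ R) a * HahnSeries.ofPowerSeries ℤ R (s9U a) := by
  conv_lhs => rw [s9U_eq]
  rw [map_mul, ← mul_assoc, HahnSeries.ofPowerSeries_X, s9x, HahnSeries.single_mul_single]
  rw [map_add (HahnSeries.ofPowerSeries ℤ R), map_mul (HahnSeries.ofPowerSeries ℤ R), s9_ofC,
    map_one (HahnSeries.ofPowerSeries ℤ R)]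
  have : (HahnSeries.single ((-1 : ℤ) + 1) ((1 : R) * 1)) = 1 := by simp
  simp only [neg_add_cancel, mul_one] at this
  simp only [Nat.cast_one, neg_add_cancel, mul_one, this, one_mul]

/-- images of the generators in the expansion at the `i`-th point -/
noncomputable def s9Val {R : Type*} [CommRing R] {n : ℕ} (α c : Fin n → Fin n → R) (i j : Fin n) :
    HahnSeries ℤ R :=
  if j = i then s9x R else HahnSeries.ofPowerSeries ℤ R
    (PowerSeries.C (α j i) + PowerSeries.C (c i j + α i j * α j i) * s9U (α i j))

theorem s9Val_rel {R : Type*} [CommRing R] {n : ℕ} (α c : Fin n → Fin n → R)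
    (hsymm : ∀ i j, c i j = c j i)
    (H : ∀ i j k : Fin n, i ≠ j → j ≠ k → i ≠ k →
        c i j = α i k * α j k - α i j * α j k - α j i * α i k)
    (i p q : Fin n) (h : p ≠ q) :
    s9Val α c i p * s9Val α c i q - algebraMap R _ (α p q) * s9Val α c i q
      - algebraMap R _ (α q p) * s9Val α c i p - algebraMap R _ (c p q) = 0 := by
  by_cases hp : p = i
  · subst hp
    simp only [s9Val, if_true, if_neg h.symm, map_add, map_mul, s9_ofC]
    linear_combination (algebraMap R (HahnSeries ℤ R) (c p q) + algebraMap R (HahnSeries ℤ R) (α p q) * algebraMap R (HahnSeries ℤ R) (α q p)) * s9xU (α p q)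
  by_cases hq : q = i
  · subst hq
    rw [hsymm p q]
    simp only [s9Val, if_true, if_neg h, map_add, map_mul, s9_ofC]
    linear_combination (algebraMap R (HahnSeries ℤ R) (c q p) + algebraMap R (HahnSeries ℤ R) (α q p) * algebraMap R (HahnSeries ℤ R) (α p q)) * s9xU (α q p)
  · simp only [s9Val, if_neg hp, if_neg hq, map_add, map_mul, s9_ofC]
    rw [H p q i h hq hp, H i p q (Ne.symm hp) h (Ne.symm hq),
      H i q p (Ne.symm hq) h.symm (Ne.symm hp)]
    have h1 := s9xU (α i p)
    have h2 := s9xU (α i q)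
    simp only [map_add, map_mul, map_sub]
    generalize HahnSeries.ofPowerSeries ℤ R (s9U (α i p)) = u at *
    generalize HahnSeries.ofPowerSeries ℤ R (s9U (α i q)) = v at *
    generalize algebraMap R (HahnSeries ℤ R) (α i p) = aip at *
    generalize algebraMap R (HahnSeries ℤ R) (α i q) = aiq at *
    generalize algebraMap R (HahnSeries ℤ R) (α p i) = api at *
    generalize algebraMap R (HahnSeries ℤ R) (α q i) = aqi at *
    generalize algebraMap R (HahnSeries ℤ R) (α p q) = apq at *
    generalize algebraMap R (HahnSeries ℤ R) (α q p) = aqp at *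
    have h3 : (aiq - aip) * u * v + u - v = 0 := by
      linear_combination v * h1 - u * h2
    linear_combination (-(aiq - aip) * (apq - api) * (aqp - aqi)) * h3

open MvPolynomial in
noncomputable def s9Hom {R : Type*} [CommRing R] {n : ℕ} (α c : Fin n → Fin n → R)
    (hsymm : ∀ i j, c i j = c j i)
    (H : ∀ i j k : Fin n, i ≠ j → j ≠ k → i ≠ k →
        c i j = α i k * α j k - α i j * α j k - α j i * α i k) (i : Fin n) :
    (MvPolynomial (Fin n) R ⧸ stmt9Ideal n α c) →ₐ[R] HahnSeries ℤ R :=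
  Ideal.Quotient.liftₐ _ (aeval (s9Val α c i)) (by
    have : stmt9Ideal n α c ≤ RingHom.ker (aeval (R := R) (s9Val α c i)) := by
      unfold stmt9Ideal
      rw [Ideal.span_le]
      rintro P ⟨p, q, h, rfl⟩
      have := s9Val_rel α c hsymm H i p q h
      simpa [RingHom.mem_ker, MvPolynomial.algHom_C] using this
    exact fun a ha => this ha)

theorem s9Hom_X {R : Type*} [CommRing R] {n : ℕ} (α c : Fin n → Fin n → R)
    (hsymm : ∀ i j, c i j = c j i)
    (H : ∀ i j k : Fin n, i ≠ j → j ≠ k → i ≠ k →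
        c i j = α i k * α j k - α i j * α j k - α j i * α i k) (i j : Fin n) :
    s9Hom α c hsymm H i (Ideal.Quotient.mk _ (MvPolynomial.X j)) = s9Val α c i j := by
  unfold s9Hom
  erw [Ideal.Quotient.liftₐ_apply, Ideal.Quotient.lift_mk]
  simp

theorem s9_coeff_neg {R : Type*} [CommRing R] (f : PowerSeries R) (m : ℕ) :
    (HahnSeries.ofPowerSeries ℤ R f).coeff (-(m+1 : ℤ)) = 0 := by
  rw [HahnSeries.ofPowerSeries_apply]
  apply HahnSeries.embDomain_of_notMem_range
  rintro ⟨k, hk⟩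
  simp at hk
  omega

theorem s9_coeff {R : Type*} [CommRing R] {n : ℕ} (α c : Fin n → Fin n → R)
    (hsymm : ∀ i j, c i j = c j i)
    (H : ∀ i j k : Fin n, i ≠ j → j ≠ k → i ≠ k →
        c i j = α i k * α j k - α i j * α j k - α j i * α i k) (i : Fin n) (m : ℕ)
    (q : Option (Fin n × ℕ)) :
    (s9Hom α c hsymm H i (stmt9Monomial n α c q)).coeff (-(m+1 : ℤ)) =
      if q = some (i, m) then 1 else 0 := by
  rcases q with _ | ⟨j, k⟩
  · have := s9_coeff_neg (1 : PowerSeries R) m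
    simpa [stmt9Monomial] using this
  · simp only [stmt9Monomial, Option.elim, map_pow, s9Hom_X]
    by_cases hj : j = i
    · subst hj
      simp only [s9Val, if_true, s9x, HahnSeries.single_pow, one_pow, HahnSeries.coeff_single]
      congr 1
      simp only [Option.some.injEq, Prod.mk.injEq, true_and, eq_iff_iff]
      simp
      omega
    · rw [s9Val, if_neg hj, ← map_pow, s9_coeff_neg, if_neg]
      simp [hj]

theorem s9_hom_smul {R : Type*} [CommRing R] {n : ℕ} (α c : Fin n → Fin n → R)
    (hsymm : ∀ i j, c i j = c j i)
    (H : ∀ i j k : Fin n, i ≠ j → j ≠ k → i ≠ k →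
        c i j = α i k * α j k - α i j * α j k - α j i * α i k) (i : Fin n) (r : R)
    (x : MvPolynomial (Fin n) R ⧸ stmt9Ideal n α c) :
    s9Hom α c hsymm H i (r • x) = r • s9Hom α c hsymm H i x :=
  by
  rw [s9_smul, map_mul, AlgHom.commutes, ← s9_ofC, HahnSeries.ofPowerSeries_C,
    HahnSeries.C_mul_eq_smul]

theorem s9_indep {R : Type*} [CommRing R] (n : ℕ) (hn : 3 ≤ n) (α c : Fin n → Fin n → R)
    (hsymm : ∀ i j, c i j = c j i)
    (H : ∀ i j k : Fin n, i ≠ j → j ≠ k → i ≠ k →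
        c i j = α i k * α j k - α i j * α j k - α j i * α i k) :
    LinearIndependent R (stmt9Monomial n α c) := by
  rw [linearIndependent_iff]
  intro l hl
  have hsome : ∀ i m, l (some (i, m)) = 0 := by
    intro i m
    have h := congrArg (fun y => (s9Hom α c hsymm H i y).coeff (-(m+1 : ℤ))) hl
    simp only [Finsupp.linearCombination_apply, Finsupp.sum, map_sum, s9_hom_smul,
      HahnSeries.coeff_sum, HahnSeries.coeff_smul, s9_coeff, map_zero, HahnSeries.coeff_zero] at h
    simp only [smul_eq_mul, mul_ite, mul_one, mul_zero, Finset.sum_ite_eq', Finsupp.mem_support_iff,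
      ne_eq, ite_not] at h
    by_contra h0
    exact h0 (by simpa [h0] using h)
  have hl' : l = Finsupp.single none (l none) := by
    ext q
    rcases q with _ | ⟨i, m⟩
    · simp
    · simp [hsome]
  rw [hl'] at hl
  have h := congrArg (fun y => (s9Hom α c hsymm H ⟨0, by omega⟩ y).coeff 0) hl
  simp [stmt9Monomial, s9_hom_smul] at h
  rw [hl', h]
  simp

theorem s9_forward {R : Type*} [CommRing R] (n : ℕ) (α c : Fin n → Fin n → R)
    (hl : LinearIndependent R (stmt9Monomial n α c)) (i j k : Fin n)
    (hij : i ≠ j) (hjk : j ≠ k) (hik : i ≠ k) :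
    c i j = α i k * α j k - α i j * α j k - α j i * α i k := by
  have h1 := s9_rel n α c i j hij
  have h2 := s9_rel n α c j k hjk
  have h3 := s9_rel n α c i k hik
  have hinj : Function.Injective ![some (k, 0), some (j, 0), some (i, 0), (none : Option (Fin n × ℕ))] := by
    intro a b hab
    fin_cases a <;> fin_cases b <;>
      simp [hij, hjk, hik, hij.symm, hjk.symm, hik.symm] at hab ⊢
  have h4 := Fintype.linearIndependent_iff.mp (hl.comp _ hinj)
    ![α i j * α j k + α j i * α i k + c i j - α j k * α i k,
      0,
      α j i * α k i - α j k * α k i - α k j * α j i - c j k,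
      α i j * c j k + α j i * c i k - α j k * c i k - α k j * c i j] (by
        simp [Fin.sum_univ_four, stmt9Monomial, s9_smul]
        generalize (Ideal.Quotient.mk (stmt9Ideal n α c) (MvPolynomial.X i)) = x at *
        generalize (Ideal.Quotient.mk (stmt9Ideal n α c) (MvPolynomial.X j)) = y at *
        generalize (Ideal.Quotient.mk (stmt9Ideal n α c) (MvPolynomial.X k)) = z at *
        have e1 := congrArg (· * z) h1
        have e2 := congrArg (x * ·) h2
        beta_reduce at e1 e2
        linear_combination e2 - e1 - algebraMap R _ (α i j) * h2 - algebraMap R _ (α j i) * h3 + algebraMap R _ (α j k) * h3 + algebraMap R _ (α k j) * h1) 0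
  simp at h4
  linear_combination h4

/-- Over a commutative ring `R`, the algebra `A` generated by `f₁,…,fₙ`
with relations `fᵢfⱼ = αᵢⱼfⱼ + αⱼᵢfᵢ + cᵢⱼ` for `i ≠ j` (where `cᵢⱼ = cⱼᵢ`) has
`{1} ∪ {fᵢᵐ : m ≥ 1}` as an `R`-basis if and only if for all triples of distinct indices
`i, j, k` one has `cᵢⱼ = αᵢₖαⱼₖ − αᵢⱼαⱼₖ − αⱼᵢαᵢₖ`. -/
theorem stmt9 {R : Type*} [CommRing R] (n : ℕ) (hn : 3 ≤ n)
    (α c : Fin n → Fin n → R) (hsymm : ∀ i j, c i j = c j i) :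
    (LinearIndependent R (stmt9Monomial n α c) ∧
        Submodule.span R (Set.range (stmt9Monomial n α c)) = ⊤) ↔
      (∀ i j k : Fin n, i ≠ j → j ≠ k → i ≠ k →
        c i j = α i k * α j k - α i j * α j k - α j i * α i k) := by
  constructor
  · rintro ⟨hl, -⟩ i j k hij hjk hik
    exact s9_forward n α c hl i j k hij hjk hik
  · intro H
    exact ⟨s9_indep n hn α c hsymm H, s9_span n α c⟩
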